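/- arXiv:2202.02075 — 4 statements merged into one kernel-verified Lean document; each statement's English description precedes it below -/
import Mathlib

section
/- Let R be a commutative ring, n, r ≥ 1, and x_1, …, x_n ∈ R. Suppose {1, 2, …, n+r-1} is partitioned into disjoint subsets {i_1 < ⋯ < i_{n-1}} and {j_1 < ⋯ < j_r}. Let M be the n×n matrix whose (k,t) entry is x_k^{i_t - 1} for t = 1, …, n-1 and whose last column has entries x_k^{n+r-1}. Let Q_r be the r×r submatrix of P formed by rows j_1, …, j_r of P. Then det M = (-1)^{n(n-1)/2 + i_1 + ⋯ + i_{n-1}} · det Q_r · det V_n. -/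
/-- `ebar x m` is the `m`-th elementary symmetric polynomial `ē_m(x_1,…,x_n)`
of the entries of `x`; it equals `1` for `m = 0` and `0` for `m > n`. -/
def ebar {R : Type*} [CommRing R] {n : ℕ} (x : Fin n → R) (m : ℕ) : R :=
  ∑ s ∈ Finset.powersetCard m (Finset.univ : Finset (Fin n)), ∏ i ∈ s, x i

/-- The signed elementary symmetric polynomial, indexed by `m : ℤ`:
`e_m = (-1)^{m-1} ē_m` for `0 ≤ m ≤ n` (in particular `e_0 = -1`), and `e_m = 0`
for `m < 0` or `m > n`.  (Note `(-1)^{m-1} = (-1)^{m+1}`.) -/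
def esigned {R : Type*} [CommRing R] {n : ℕ} (x : Fin n → R) (m : ℤ) : R :=
  if 0 ≤ m ∧ m ≤ (n : ℤ) then (-1 : R) ^ (m + 1).toNat * ebar x m.toNat else 0

open Polynomial in
lemma aux_coeff {R : Type*} [CommRing R] {n : ℕ} (x : Fin n → R) (s c : ℕ) :
    esigned x ((n : ℤ) - s + c) = -((X ^ c * ∏ k, (X - C (x k)) : R[X]).coeff s) := by
  have hp : (∏ k, (X - C (x k)) : R[X])
      = (((Finset.univ : Finset (Fin n)).val.map x).map fun t => X - C t).prod := by
    rw [Multiset.map_map]; rfl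
  have hcard : Multiset.card ((Finset.univ : Finset (Fin n)).val.map x) = n := by simp
  rw [coeff_X_pow_mul', esigned]
  by_cases hc : c ≤ s
  · rw [if_pos hc]
    by_cases hs : s - c ≤ n
    · rw [if_pos (by omega), hp, Multiset.prod_X_sub_C_coeff _ (by rw [hcard]; exact hs), hcard,
        Finset.esymm_map_val, ebar]
      have h1 : ((n : ℤ) - s + c + 1).toNat = (n - (s - c)) + 1 := by omega
      have h2 : ((n : ℤ) - s + c).toNat = (n - (s - c)) := by omega
      rw [h1, h2, pow_succ]
      ring
    · rw [if_neg (by omega), coeff_eq_zero_of_natDegree_lt, neg_zero]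
      refine lt_of_le_of_lt ?_ (not_le.mp hs)
      refine (natDegree_prod_le _ _).trans ?_
      refine (Finset.sum_le_card_nsmul _ _ 1 fun k _ => natDegree_X_sub_C_le _).trans ?_
      simp
  · rw [if_neg hc, if_neg (by omega), neg_zero]

open Polynomial in
lemma aux_sum {R : Type*} [CommRing R] {n r : ℕ} (x : Fin n → R) (k : Fin n) (c : Fin r) :
    ∑ s : Fin (n + r), x k ^ (s : ℕ) * esigned x ((n : ℤ) - (s : ℕ) + (c : ℕ)) = 0 := by
  have hdeg : (X ^ (c : ℕ) * ∏ k, (X - C (x k)) : R[X]).natDegree < n + r := by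
    refine lt_of_le_of_lt natDegree_mul_le ?_
    have h1 : (∏ k, (X - C (x k)) : R[X]).natDegree ≤ n := by
      refine (natDegree_prod_le _ _).trans ?_
      refine (Finset.sum_le_card_nsmul _ _ 1 fun k _ => natDegree_X_sub_C_le _).trans ?_
      simp
    have h2 : (X ^ (c : ℕ) : R[X]).natDegree ≤ c := natDegree_X_pow_le _
    have := c.2
    omega
  have h := eval_eq_sum_range' hdeg (x k)
  rw [eval_mul, eval_prod, Finset.prod_eq_zero (Finset.mem_univ k) (by simp), mul_zero,
    Finset.sum_range] at h
  simp_rw [aux_coeff]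
  rw [← neg_eq_zero, ← Finset.sum_neg_distrib, h]
  refine Finset.sum_congr rfl fun s _ => ?_
  ring

lemma aux_count {n r : ℕ} (f : Fin n → Fin (n + r)) (g : Fin r → Fin (n + r))
    (hf : StrictMono f) (hb : Function.Bijective (Sum.elim f g)) (t : Fin n) :
    (Finset.univ.filter fun b => g b < f t).card + t = f t := by
  have h1 : (Finset.univ.filter fun p => Sum.elim f g p < f t).card = (f t : ℕ) := by
    rw [← Fin.card_Iio (f t)]
    refine Finset.card_bij (fun p _ => Sum.elim f g p) ?_ ?_ ?_
    · intro p hp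
      simpa using hp
    · intro p _ q _ h
      exact hb.1 h
    · intro q hq
      obtain ⟨p, rfl⟩ := hb.2 q
      exact ⟨p, by simpa using hq, rfl⟩
  rw [Finset.card_filter, Fintype.sum_sum_type] at h1
  have h2 : (∑ s : Fin n, if f s < f t then 1 else 0) = (t : ℕ) := by
    simp only [hf.lt_iff_lt]
    rw [← Finset.card_filter, Finset.filter_gt_eq_Iio, Fin.card_Iio]
  have h3 : (∑ s : Fin n, if f s < f t then 1 else 0)
      + (∑ b : Fin r, if g b < f t then 1 else 0) = (f t : ℕ) := h1
  rw [Finset.card_filter]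
  omega

lemma aux_sign {n r : ℕ} (f : Fin n → Fin (n + r)) (g : Fin r → Fin (n + r))
    (hf : StrictMono f) (hg : StrictMono g) (hb : Function.Bijective (Sum.elim f g))
    (σ : Equiv.Perm (Fin (n + r))) (h1 : ∀ t, σ (Fin.castAdd r t) = f t)
    (h2 : ∀ b, σ (Fin.natAdd n b) = g b) :
    Equiv.Perm.sign σ = (-1) ^ (∑ t, ((f t : ℕ) + t)) := by
  have key : ∀ i : Fin (n + r), ∏ j ∈ Finset.Ioi i, (if σ i < σ j then (1 : ℤˣ) else -1)
      = ∏ j, if i < j then (if σ i < σ j then (1 : ℤˣ) else -1) else 1 := by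
    intro i
    rw [← Finset.filter_lt_eq_Ioi, Finset.prod_filter]
  rw [Equiv.Perm.sign_eq_prod_prod_Ioi]
  simp_rw [key]
  rw [Fin.prod_univ_add]
  simp_rw [Fin.prod_univ_add, h1, h2]
  have e1 : ∀ t s : Fin n, (if Fin.castAdd r t < Fin.castAdd r s then
      (if f t < f s then (1 : ℤˣ) else -1) else 1) = 1 := by
    intro t s
    split_ifs with a b
    · rfl
    · exact absurd (hf (show t < s from a)) b
    · rfl
  have e2 : ∀ t s : Fin r, (if Fin.natAdd n t < Fin.natAdd n s then
      (if g t < g s then (1 : ℤˣ) else -1) else 1) = 1 := by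
    intro t s
    split_ifs with a b
    · rfl
    · exact absurd (hg (by simpa using a)) b
    · rfl
  have e3 : ∀ (t : Fin r) (s : Fin n), ¬ (Fin.natAdd n t < Fin.castAdd r s) := by
    intro t s
    simp only [Fin.lt_def, Fin.val_natAdd, Fin.val_castAdd]
    omega
  have e4 : ∀ (t : Fin n) (s : Fin r), Fin.castAdd r t < Fin.natAdd n s := by
    intro t s
    simp only [Fin.lt_def, Fin.val_natAdd, Fin.val_castAdd]
    omega
  have e5 : ∀ t, ∏ b, (if f t < g b then (1 : ℤˣ) else -1) = (-1) ^ ((f t : ℕ) + t) := by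
    intro t
    have : ∀ b, (if f t < g b then (1 : ℤˣ) else -1) = if g b < f t then -1 else 1 := by
      intro b
      have hne : f t ≠ g b := fun h => by
        have := @hb.1 (Sum.inl t) (Sum.inr b) h
        simp at this
      rcases lt_or_gt_of_ne hne with h | h
      · rw [if_pos h, if_neg h.asymm]
      · rw [if_pos h, if_neg h.asymm]
    simp_rw [this]
    rw [← Finset.prod_filter, Finset.prod_const, ← aux_count f g hf hb t, add_assoc, pow_add,
      ← two_mul, pow_mul]
    simp
  simp only [e1, e2, e3, e4, if_true, if_false, Finset.prod_const_one, one_mul, mul_one, e5]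
  rw [Finset.prod_pow_eq_pow_sum]

lemma aux_core {R : Type*} [CommRing R] {n r : ℕ} (x : Fin n → R)
    (f : Fin n → Fin (n + r)) (g : Fin r → Fin (n + r))
    (hf : StrictMono f) (hg : StrictMono g) (hb : Function.Bijective (Sum.elim f g)) :
    (Matrix.of fun k t : Fin n => x k ^ (f t : ℕ)).det
      = (-1 : R) ^ (∑ t, ((f t : ℕ) + t) + r) *
        (Matrix.of fun a b : Fin r => esigned x ((n : ℤ) - (g a : ℕ) + (b : ℕ))).det *
        (Matrix.of fun k t : Fin n => x k ^ (t : ℕ)).det := by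
  classical
  let A : Matrix (Fin n ⊕ Fin r) (Fin (n + r)) R := Matrix.of fun p q =>
    Sum.elim (fun k => x k ^ (q : ℕ)) (fun a => if q = g a then 1 else 0) p
  let B : Matrix (Fin (n + r)) (Fin n ⊕ Fin r) R := Matrix.of fun q p =>
    Sum.elim (fun t => if q = Fin.castAdd r t then 1 else 0)
      (fun b : Fin r => esigned x ((n : ℤ) - (q : ℕ) + (b : ℕ))) p
  let e0 : Fin n ⊕ Fin r ≃ Fin (n + r) := finSumFinEquiv
  let φ : Fin n ⊕ Fin r ≃ Fin (n + r) := Equiv.ofBijective _ hb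
  have hAB : A * B = Matrix.fromBlocks (Matrix.of fun k t : Fin n => x k ^ (t : ℕ)) 0
      (Matrix.of fun a t => if Fin.castAdd r t = g a then 1 else 0)
      (Matrix.of fun a b : Fin r => esigned x ((n : ℤ) - (g a : ℕ) + (b : ℕ))) := by
    ext p q
    rcases p with k | a <;> rcases q with t | b
    · simp [A, B, Matrix.mul_apply]
    · simpa [A, B, Matrix.mul_apply] using aux_sum x k b
    · simp [A, B, Matrix.mul_apply, eq_comm]
    · simp [A, B, Matrix.mul_apply]
  have hB : B.submatrix e0 id = Matrix.fromBlocks 1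
      (Matrix.of fun (t : Fin n) (b : Fin r) => esigned x ((n : ℤ) - (t : ℕ) + (b : ℕ))) 0
      (Matrix.of fun (a b : Fin r) => esigned x ((b : ℤ) - (a : ℕ))) := by
    ext p q
    rcases p with k | a <;> rcases q with t | b
    · simp [B, e0, Matrix.one_apply]
    · simp [B, e0]
    · simp only [B, e0, Matrix.submatrix_apply, finSumFinEquiv_apply_right, Matrix.of_apply,
        Sum.elim_inl, id, Matrix.fromBlocks_apply₂₁, Matrix.zero_apply]
      rw [if_neg]
      intro h
      have := congrArg Fin.val h
      simp only [Fin.val_natAdd, Fin.val_castAdd] at this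
      omega
    · simp only [B, e0, Matrix.submatrix_apply, finSumFinEquiv_apply_right, Matrix.of_apply,
        Sum.elim_inr, id, Matrix.fromBlocks_apply₂₂]
      congr 1
      simp only [Fin.val_natAdd]
      push_cast
      ring
  have hT : (Matrix.of fun (a b : Fin r) => esigned x ((b : ℤ) - (a : ℕ))).det = (-1) ^ r := by
    rw [Matrix.det_of_isUpperTriangular]
    · simp [esigned, ebar]
    · intro a b hab
      have : (b : ℕ) < a := hab
      simp only [Matrix.of_apply, esigned]
      rw [if_neg (by omega)]
  have hA : A.submatrix id φ = Matrix.fromBlocks (Matrix.of fun k t : Fin n => x k ^ (f t : ℕ))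
      (Matrix.of fun k b => x k ^ (g b : ℕ)) 0 1 := by
    ext p q
    rcases p with k | a <;> rcases q with t | b
    · simp [A, φ]
    · simp [A, φ]
    · have hne : f t ≠ g a := fun h => by
        have := @hb.1 (Sum.inl t) (Sum.inr a) h
        simp at this
      simp [A, φ, hne]
    · simp [A, φ, Matrix.one_apply, hg.injective.eq_iff, eq_comm]
  have hperm : A.submatrix id φ = (A.submatrix id e0).submatrix id (φ.trans e0.symm) := by
    ext p q
    simp
  have hsign : Equiv.Perm.sign (φ.trans e0.symm) = (-1) ^ (∑ t, ((f t : ℕ) + t)) := by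
    rw [← aux_sign f g hf hg hb (e0.symm.trans φ)]
    · rw [← Equiv.Perm.sign_symm_trans_trans (φ.trans e0.symm) e0]
      congr 1
      ext q
      simp
    · intro t
      simp [e0, φ]
    · intro t
      simp [e0, φ]
  have hmul : A.submatrix id e0 * B.submatrix e0 id = A * B := by
    rw [Matrix.submatrix_mul_equiv]; simp
  have d1 := congrArg Matrix.det hmul
  rw [Matrix.det_mul, hAB, hB, Matrix.det_fromBlocks_zero₁₂, Matrix.det_fromBlocks_zero₂₁,
    Matrix.det_one, one_mul, hT] at d1
  have d2 := congrArg Matrix.det hperm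
  rw [Matrix.det_permute', hA, Matrix.det_fromBlocks_zero₂₁, Matrix.det_one, mul_one, hsign] at d2
  rw [d2, pow_add, mul_assoc, mul_assoc, mul_comm (Matrix.det _) (Matrix.det _), ← d1]
  have : ((-1 : R) ^ r) * (-1) ^ r = 1 := by rw [← mul_pow]; simp
  push_cast
  linear_combination (-((-1 : R) ^ (∑ t, ((f t : ℕ) + t))) * (A.submatrix id e0).det) * this

/-- Suppose `{1,…,n+r-1}` is partitioned into `i_1 < ⋯ < i_{n-1}` and `j_1 < ⋯ < j_r`.
Let `M` be the `n × n` matrix whose `t`-th column is `(x_k^{i_t-1})_k` for `t ≤ n-1`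
and whose last column is `(x_k^{n+r-1})_k`.  Let `Q_r` be the submatrix of
`P = (e_{n-a+b})_{1 ≤ a ≤ n+r-1, 1 ≤ b ≤ r}` formed by rows `j_1,…,j_r`.  Then
`det M = (-1)^{n(n-1)/2 + i_1 + ⋯ + i_{n-1}} · det Q_r · det V_n`. -/
theorem subdeterminant_extended_vandermonde {R : Type*} [CommRing R]
    (n r : ℕ) (hn : 1 ≤ n) (hr : 1 ≤ r) (x : Fin n → R)
    (i : Fin (n - 1) → ℕ) (j : Fin r → ℕ) (hi : StrictMono i) (hj : StrictMono j)
    (hdisj : Disjoint (Finset.image i Finset.univ) (Finset.image j Finset.univ))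
    (hunion : Finset.image i Finset.univ ∪ Finset.image j Finset.univ
        = Finset.Icc 1 (n + r - 1)) :
    (Matrix.of fun k t : Fin n =>
        if h : (t : ℕ) < n - 1 then x k ^ (i ⟨t, h⟩ - 1) else x k ^ (n + r - 1)).det
      = (-1 : R) ^ (n * (n - 1) / 2 + ∑ t, i t) *
        (Matrix.of fun a b : Fin r =>
          esigned x ((n : ℤ) - (j a : ℤ) + (b : ℕ) + 1)).det *
        (Matrix.of fun k t : Fin n => x k ^ (t : ℕ)).det := by
  obtain ⟨m, rfl⟩ : ∃ m, n = m + 1 := ⟨n - 1, by omega⟩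
  have hmem : ∀ q, ((∃ t, i t = q) ∨ ∃ b, j b = q) ↔ 1 ≤ q ∧ q ≤ m + 1 + r - 1 := by
    intro q
    have := Finset.ext_iff.mp hunion q
    simpa using this
  have hI : ∀ t, 1 ≤ i t ∧ i t ≤ m + 1 + r - 1 := fun t => (hmem _).1 (Or.inl ⟨t, rfl⟩)
  have hJ : ∀ b, 1 ≤ j b ∧ j b ≤ m + 1 + r - 1 := fun b => (hmem _).1 (Or.inr ⟨b, rfl⟩)
  have hij : ∀ t b, i t ≠ j b := fun t b h =>
    Finset.disjoint_left.mp hdisj (Finset.mem_image_of_mem i (Finset.mem_univ t))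
      (h ▸ Finset.mem_image_of_mem j (Finset.mem_univ b))
  let F : Fin (m + 1) → ℕ := fun t => if h : (t : ℕ) < m then i ⟨t, h⟩ - 1 else m + r
  have hF : ∀ t, F t < m + 1 + r := by
    intro t
    simp only [F]
    split_ifs with h
    · have := hI ⟨t, h⟩; omega
    · omega
  let f : Fin (m + 1) → Fin (m + 1 + r) := fun t => ⟨F t, hF t⟩
  let g : Fin r → Fin (m + 1 + r) := fun b => ⟨j b - 1, by have := hJ b; omega⟩
  have hf : StrictMono f := by
    intro s t hst
    have hst' : (s : ℕ) < t := hst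
    simp only [f, F, Fin.mk_lt_mk]
    have hs : (s : ℕ) < m := by omega
    rw [dif_pos hs]
    have h1 := hI ⟨s, hs⟩
    split_ifs with h
    · have h2 : i ⟨s, hs⟩ < i ⟨t, h⟩ := hi hst'
      omega
    · omega
  have hg : StrictMono g := by
    intro s t hst
    have h1 := hJ s
    have h2 := hj hst
    simp only [g, Fin.mk_lt_mk]
    omega
  have hb : Function.Bijective (Sum.elim f g) := by
    rw [Fintype.bijective_iff_injective_and_card]
    refine ⟨?_, by simp⟩
    refine hf.injective.sumElim hg.injective ?_
    intro t b h
    simp only [f, g, F, Fin.mk.injEq] at h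
    have h2 := hJ b
    split_ifs at h with h'
    · have h1 := hI ⟨t, h'⟩
      exact hij ⟨t, h'⟩ b (by omega)
    · omega
  have key := aux_core x f g hf hg hb
  have hM : (Matrix.of fun k t : Fin (m + 1) => if h : (t : ℕ) < m + 1 - 1 then
      x k ^ (i ⟨t, h⟩ - 1) else x k ^ (m + 1 + r - 1))
      = Matrix.of fun k t : Fin (m + 1) => x k ^ (f t : ℕ) := by
    ext k t
    simp only [Matrix.of_apply, f, F]
    have : m + 1 + r - 1 = m + r := by omega
    rw [this]
    by_cases h : (t : ℕ) < m
    · rw [dif_pos h]; exact dif_pos h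
    · rw [dif_neg h]; exact dif_neg h
  have hQ : (Matrix.of fun a b : Fin r =>
      esigned x (((m + 1 : ℕ) : ℤ) - (j a : ℤ) + (b : ℕ) + 1))
      = Matrix.of fun a b : Fin r =>
        esigned x (((m + 1 : ℕ) : ℤ) - (g a : ℕ) + (b : ℕ)) := by
    ext a b
    simp only [Matrix.of_apply, g]
    congr 1
    have := hJ a
    omega
  have hsum : ∑ t, ((f t : ℕ) + t) + r
      = (m + 1) * (m + 1 - 1) / 2 + ∑ t, i t + 2 * r := by
    rw [Finset.sum_add_distrib, ← Finset.sum_range_id, Finset.sum_range,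
      Fin.sum_univ_castSucc (fun t => (f t : ℕ)), Fin.sum_univ_castSucc (fun t => (t : ℕ))]
    have h1 : ∑ t : Fin m, (f t.castSucc : ℕ) + m = ∑ t : Fin m, i t := by
      have : ∀ t : Fin m, i t = (f t.castSucc : ℕ) + 1 := by
        intro t
        have := hI t
        simp only [f, F, Fin.val_castSucc, t.2, dif_pos, Fin.eta]
        omega
      rw [Finset.sum_congr rfl fun t _ => this t, Finset.sum_add_distrib]
      simp
    have h2 : (f (Fin.last m) : ℕ) = m + r := by simp [f, F]
    have h3 : ∑ t : Fin (m + 1 - 1), i t = ∑ t : Fin m, i t := rfl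
    rw [h2, h3, ← h1]
    simp only [Fin.val_last]
    omega
  rw [hM, hQ, key, hsum, pow_add _ _ (2 * r), pow_mul]
  simp
end

section
/- Let R be a commutative ring, n, r ≥ 1, and x_1, …, x_n ∈ R. Let M be the n×n matrix whose (k,t) entry is x_k^{t-1} for t = 1, …, n-1 and whose last column has entries x_k^{n+r-1}. Let T_r be the r×r Toeplitz–Hessenberg matrix with (a,b) entry equal to e_{b-a+1} (that is, (-1)^{b-a} ē_{b-a+1} for a ≤ b ≤ a+n-1, the entry -1 when b = a-1, and 0 otherwise). Then det M = det T_r · det V_n. -/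
theorem esigned_zero' {R : Type*} [CommRing R] {n : ℕ} (x : Fin n → R) : esigned x 0 = -1 := by
  simp [esigned, ebar]

theorem esigned_neg' {R : Type*} [CommRing R] {n : ℕ} (x : Fin n → R) (m : ℤ) (h : m < 0) :
    esigned x m = 0 := by
  unfold esigned
  rw [if_neg (by omega)]

theorem esigned_big' {R : Type*} [CommRing R] {n : ℕ} (x : Fin n → R) (m : ℤ) (h : (n : ℤ) < m) :
    esigned x m = 0 := by
  unfold esigned
  rw [if_neg (by omega)]

theorem pow_rec' {R : Type*} [CommRing R] {n : ℕ} (x : Fin n → R) (k : Fin n) :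
    x k ^ n = ∑ i ∈ Finset.range n, esigned x ((i : ℤ) + 1) * x k ^ (n - 1 - i) := by
  have h0 : ∏ i : Fin n, (-x i + x k) = 0 :=
    Finset.prod_eq_zero (Finset.mem_univ k) (by ring)
  rw [Finset.prod_add, Finset.sum_powerset] at h0
  have h1 : ∀ j ∈ Finset.range (n + 1),
      ∑ t ∈ Finset.powersetCard j (Finset.univ : Finset (Fin n)),
        ((∏ i ∈ t, -x i) * ∏ i ∈ Finset.univ \ t, x k) = - (esigned x (j : ℤ) * x k ^ (n - j)) := by
    intro j hj
    rw [Finset.mem_range] at hj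
    unfold esigned ebar
    rw [if_pos (by omega), Finset.mul_sum, Finset.sum_mul, ← Finset.sum_neg_distrib]
    refine Finset.sum_congr (by simp) ?_
    intro t ht
    have hc := (Finset.mem_powersetCard.1 ht).2
    rw [Finset.prod_neg, Finset.prod_const, Finset.card_sdiff_of_subset (Finset.subset_univ t), hc]
    have : ((j : ℤ) + 1).toNat = j + 1 := by omega
    rw [this, Finset.card_univ, Fintype.card_fin, Int.toNat_natCast]
    ring
  rw [Finset.card_univ, Fintype.card_fin, Finset.sum_congr rfl h1, Finset.sum_range_succ'] at h0
  simp only [Nat.cast_zero, esigned_zero', Finset.sum_neg_distrib] at h0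
  have h2 : ∑ i ∈ Finset.range n, esigned x ((i : ℤ) + 1) * x k ^ (n - 1 - i)
      = ∑ i ∈ Finset.range n, esigned x ((i + 1 : ℕ) : ℤ) * x k ^ (n - (i + 1)) := by
    refine Finset.sum_congr rfl ?_
    intro i _
    rw [Nat.sub_sub, add_comm 1 i]
    push_cast
    rfl
  rw [h2]
  simp only [Nat.sub_zero] at h0
  linear_combination h0

/-- Toeplitz matrix. -/
def Tmat {R : Type*} [CommRing R] (e : ℤ → R) (r : ℕ) : Matrix (Fin r) (Fin r) R :=
  Matrix.of fun a b => e ((b : ℤ) - (a : ℤ) + 1)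

/-- Toeplitz matrix with first row replaced by `u`. -/
def Hmat {R : Type*} [CommRing R] (e : ℤ → R) (u : ℕ → R) (r : ℕ) : Matrix (Fin r) (Fin r) R :=
  Matrix.of fun a b => if (a : ℕ) = 0 then u b else e ((b : ℤ) - (a : ℤ) + 1)

theorem Hmat_step {R : Type*} [CommRing R] (e : ℤ → R) (h0 : e 0 = -1) (hneg : ∀ m < 0, e m = 0)
    (u : ℕ → R) (r : ℕ) :
    (Hmat e u (r + 2)).det = u 0 * (Tmat e (r + 1)).det + (Hmat e (fun i => u (i + 1)) (r + 1)).det := by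
  rw [Matrix.det_succ_column_zero, Fin.sum_univ_succ, Fin.sum_univ_succ, Finset.sum_eq_zero]
  · have e1 : (Hmat e u (r + 2)).submatrix (Fin.succAbove 0) Fin.succ = Tmat e (r + 1) := by
      ext a b
      simp [Hmat, Tmat]
    have e2 : (Hmat e u (r + 2)).submatrix (Fin.succAbove (Fin.succ 0)) Fin.succ
        = Hmat e (fun i => u (i + 1)) (r + 1) := by
      ext a b
      refine Fin.cases ?_ (fun a => ?_) a
      · simp [Hmat]
      · rw [Matrix.submatrix_apply, Fin.succ_succAbove_succ]
        simp [Hmat]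
    rw [e1, e2]
    simp [Hmat, h0]
  · intro i _
    have : Hmat e u (r + 2) i.succ.succ 0 = 0 := by
      simp only [Hmat, Matrix.of_apply]
      rw [if_neg (by simp), hneg]
      simp
      omega
    rw [this]
    ring

theorem Hmat_det {R : Type*} [CommRing R] (e : ℤ → R) (h0 : e 0 = -1) (hneg : ∀ m < 0, e m = 0)
    (r : ℕ) : ∀ u : ℕ → R,
    (Hmat e u (r + 1)).det = ∑ i ∈ Finset.range (r + 1), u i * (Tmat e (r - i)).det := by
  induction r with
  | zero =>
    intro u
    simp [Hmat]
  | succ r ih =>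
    intro u
    rw [Hmat_step e h0 hneg, ih, Finset.sum_range_succ' _ (r + 1)]
    rw [add_comm]
    congr 1
    refine Finset.sum_congr rfl ?_
    intro i _
    rw [Nat.add_sub_add_right]

theorem Tmat_rec {R : Type*} [CommRing R] (e : ℤ → R) (h0 : e 0 = -1) (hneg : ∀ m < 0, e m = 0)
    (r : ℕ) : (Tmat e (r + 1)).det
      = ∑ i ∈ Finset.range (r + 1), e ((i : ℤ) + 1) * (Tmat e (r - i)).det := by
  rw [← Hmat_det e h0 hneg r (fun i => e ((i : ℤ) + 1))]
  congr 1
  ext a b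
  simp only [Hmat, Tmat, Matrix.of_apply]
  split_ifs with h
  · simp [h]
  · rfl

/-- Vandermonde with last column replaced by powers `m`. -/
def Wmat {R : Type*} [CommRing R] {n : ℕ} (x : Fin (n + 1) → R) (m : ℕ) :
    Matrix (Fin (n + 1)) (Fin (n + 1)) R :=
  (Matrix.of fun k t : Fin (n + 1) => x k ^ (t : ℕ)).updateCol (Fin.last n) (fun k => x k ^ m)

theorem Wmat_small {R : Type*} [CommRing R] {n : ℕ} (x : Fin (n + 1) → R) (m : ℕ) (h : m < n) :
    (Wmat x m).det = 0 := by
  have hne : (⟨m, by omega⟩ : Fin (n + 1)) ≠ Fin.last n := by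
    intro hh
    have := congrArg Fin.val hh
    simp at this
    omega
  refine Matrix.det_zero_of_column_eq hne ?_
  intro k
  rw [Wmat, Matrix.updateCol_ne hne, Matrix.updateCol_self]
  simp

theorem Wmat_rec {R : Type*} [CommRing R] {n : ℕ} (x : Fin (n + 1) → R) (m : ℕ) :
    (Wmat x (n + 1 + m)).det
      = ∑ i ∈ Finset.range (n + 1), esigned x ((i : ℤ) + 1) * (Wmat x (n + m - i)).det := by
  have h : (fun k => x k ^ (n + 1 + m))
      = ∑ i ∈ Finset.range (n + 1), esigned x ((i : ℤ) + 1) • (fun k => x k ^ (n + m - i)) := by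
    ext k
    rw [pow_add, pow_rec', Finset.sum_apply, Finset.sum_mul]
    refine Finset.sum_congr rfl ?_
    intro i hi
    rw [Finset.mem_range] at hi
    rw [Pi.smul_apply, smul_eq_mul, mul_assoc, ← pow_add]
    congr 2
    omega
  have key : ∀ s : Finset ℕ, ((Matrix.of fun k t : Fin (n + 1) => x k ^ (t : ℕ)).updateCol
      (Fin.last n) (∑ i ∈ s, esigned x ((i : ℤ) + 1) • (fun k => x k ^ (n + m - i)))).det
      = ∑ i ∈ s, esigned x ((i : ℤ) + 1) * (Wmat x (n + m - i)).det := by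
    intro s
    induction s using Finset.induction_on with
    | empty =>
      rw [Finset.sum_empty, Finset.sum_empty]
      exact Matrix.det_eq_zero_of_column_eq_zero (Fin.last n) (by intro k; simp)
    | insert a s ha ih =>
      rw [Finset.sum_insert ha, Finset.sum_insert ha, Matrix.det_updateCol_add,
        Matrix.det_updateCol_smul, ih]
      rfl
  rw [← key, ← h]
  rfl

theorem Wmat_det {R : Type*} [CommRing R] {n : ℕ} (x : Fin (n + 1) → R) (r : ℕ) :
    (Wmat x (n + r)).det = (Tmat (esigned x) r).det *
        (Matrix.of fun k t : Fin (n + 1) => x k ^ (t : ℕ)).det := by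
  induction r using Nat.strong_induction_on with
  | _ r ih =>
  rcases r with _ | r
  · rw [Matrix.det_isEmpty (A := Tmat (esigned x) 0), one_mul, Wmat]
    congr 1
    ext k t
    rw [Matrix.updateCol_apply]
    split_ifs with h
    · simp [h]
    · rfl
  · rw [show n + (r + 1) = n + 1 + r by ring, Wmat_rec,
      Tmat_rec _ (esigned_zero' x) (esigned_neg' x), Finset.sum_mul]
    have h1 : ∀ i ∈ Finset.range (r + 1), esigned x ((i : ℤ) + 1) * (Tmat (esigned x) (r - i)).det *
        (Matrix.of fun k t : Fin (n + 1) => x k ^ (t : ℕ)).det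
        = esigned x ((i : ℤ) + 1) * (Wmat x (n + r - i)).det := by
      intro i hi
      rw [Finset.mem_range] at hi
      rw [mul_assoc, ← ih (r - i) (by omega), Nat.add_sub_assoc (by omega)]
    rw [Finset.sum_congr rfl h1]
    rcases le_total n r with h | h
    · refine Finset.sum_subset (Finset.range_mono (by omega)) ?_
      intro i _ hi
      rw [Finset.mem_range] at hi
      rw [esigned_big' x _ (by push_cast; omega), zero_mul]
    · symm
      refine Finset.sum_subset (Finset.range_mono (by omega)) ?_
      intro i hi hi'
      rw [Finset.mem_range] at hi hi'
      rw [Wmat_small x _ (by omega), mul_zero]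


/-- Let `M` be the `n × n` matrix with `(k,t)` entry `x_k^{t-1}` for `t = 1,…,n-1`
and last column `(x_k^{n+r-1})_k`, and let `T_r` be the `r × r` Toeplitz–Hessenberg
matrix with `(a,b)` entry `e_{b-a+1}`.  Then `det M = det T_r · det V_n`. -/
theorem det_toeplitz_hessenberg {R : Type*} [CommRing R]
    (n r : ℕ) (hn : 1 ≤ n) (hr : 1 ≤ r) (x : Fin n → R) :
    (Matrix.of fun k t : Fin n =>
        if (t : ℕ) < n - 1 then x k ^ (t : ℕ) else x k ^ (n + r - 1)).det
      = (Matrix.of fun a b : Fin r =>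
          esigned x ((b : ℤ) - (a : ℤ) + 1)).det *
        (Matrix.of fun k t : Fin n => x k ^ (t : ℕ)).det := by

  obtain ⟨n, rfl⟩ : ∃ m, n = m + 1 := ⟨n - 1, by omega⟩
  have h := Wmat_det x r
  rw [Tmat] at h
  rw [← h]
  congr 1
  ext k t
  rw [Wmat, Matrix.updateCol_apply]
  simp only [Matrix.of_apply]
  by_cases ht : t = Fin.last n
  · rw [if_pos ht, if_neg (by simp [ht])]
    congr 1
    omega
  · have : (t : ℕ) ≠ n := fun hh => ht (Fin.ext hh)
    have := t.2
    rw [if_neg ht, if_pos (by omega)]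
end

section
/- Let R be a commutative ring, n ≥ 1, x_1, …, x_n ∈ R, and fix j with 1 ≤ j ≤ n+1. Let M be the n×n matrix whose columns are the powers x_k^c for the n exponents c ∈ {0, 1, …, n} \ {j-1}, listed in increasing order of c. Then det M = ē_{n-j+1}(x_1,…,x_n) · det V_n. -/
/-- Let `M` be the `n × n` matrix whose columns are the powers `x_k^c` for the `n`
exponents `c ∈ {0,1,…,n} \ {j-1}` in increasing order (the extended Vandermonde
matrix `V_{n,n+1}` with its `j`-th column deleted).  Then
`det M = ē_{n-j+1}(x) · det V_n`. -/
theorem det_vandermonde_delete_one_column {R : Type*} [CommRing R]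
    (n : ℕ) (hn : 1 ≤ n) (x : Fin n → R) (j : ℕ) (hj1 : 1 ≤ j) (hj2 : j ≤ n + 1) :
    (Matrix.of fun k t : Fin n =>
        x k ^ (if (t : ℕ) < j - 1 then (t : ℕ) else (t : ℕ) + 1)).det
      = ebar x (n + 1 - j) * (Matrix.of fun k t : Fin n => x k ^ (t : ℕ)).det := by
  obtain ⟨m, rfl⟩ : ∃ m, j = m + 1 := ⟨j - 1, by omega⟩
  have hm : m < n + 1 := by omega
  have hcoef : ∀ (c : Fin (n + 1)),
      (Matrix.vandermonde (Fin.cons (-Polynomial.X) (fun i => Polynomial.C (x i)) :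
        Fin (n + 1) → Polynomial R)).submatrix Fin.succ c.succAbove
      = (Matrix.of fun k t : Fin n => x k ^ ((c.succAbove t : Fin (n + 1)) : ℕ)).map
          (Polynomial.C : R →+* Polynomial R) := by
    intro c
    ext1 k t
    simp only [Matrix.submatrix_apply, Matrix.vandermonde_apply, Matrix.map_apply,
      Matrix.of_apply, Fin.cons_succ, map_pow]
  have h1 := Matrix.det_succ_row_zero
    (Matrix.vandermonde (Fin.cons (-Polynomial.X) (fun i => Polynomial.C (x i)) :
        Fin (n + 1) → Polynomial R))
  have h2 : (Matrix.vandermonde (Fin.cons (-Polynomial.X) (fun i => Polynomial.C (x i)) :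
        Fin (n + 1) → Polynomial R)).det
      = (∏ i, (Polynomial.X + Polynomial.C (x i))) *
        Polynomial.C (Matrix.vandermonde x).det := by
    rw [Matrix.det_vandermonde, Matrix.det_vandermonde, Fin.prod_univ_succ]
    simp [Fin.prod_Ioi_succ, add_comm, map_prod]
  rw [h2] at h1
  have h3 : ∀ c : Fin (n + 1), (-1 : Polynomial R) ^ (c : ℕ) *
      (Matrix.vandermonde (Fin.cons (-Polynomial.X) (fun i => Polynomial.C (x i)) :
        Fin (n + 1) → Polynomial R)) 0 c *
      ((Matrix.vandermonde (Fin.cons (-Polynomial.X) (fun i => Polynomial.C (x i)) :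
        Fin (n + 1) → Polynomial R)).submatrix Fin.succ c.succAbove).det
      = Polynomial.C (Matrix.of fun k t : Fin n =>
          x k ^ ((c.succAbove t : Fin (n + 1)) : ℕ)).det * Polynomial.X ^ (c : ℕ) := by
    intro c
    rw [hcoef, ← RingHom.mapMatrix_apply, ← RingHom.map_det, Matrix.vandermonde_apply,
      Fin.cons_zero, ← mul_pow, mul_comm]
    simp
  rw [Finset.sum_congr rfl (fun c _ => h3 c)] at h1
  have h4 := congrArg (fun p => Polynomial.coeff p m) h1
  simp only [Polynomial.coeff_mul_C, Polynomial.finsetSum_coeff,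
    Polynomial.coeff_C_mul_X_pow] at h4
  rw [Finset.prod_X_add_C_coeff _ _ (by simp; omega),
    Finset.sum_eq_single (⟨m, hm⟩ : Fin (n + 1))] at h4
  · simp only [if_true, Finset.card_univ, Fintype.card_fin] at h4
    have e : n + 1 - (m + 1) = n - m := by omega
    rw [e]
    unfold ebar
    refine Eq.trans ?_ h4.symm
    congr 1
    ext k t
    simp only [Matrix.of_apply, Fin.succAbove, Fin.lt_def, Nat.add_sub_cancel,
      Fin.val_castSucc]
    split_ifs <;> simp
  · intro b _ hb
    rw [if_neg]
    intro h
    exact hb (Fin.ext h.symm)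
  · simp
end

section
/- Let R be a commutative ring, n ≥ 1, x_1, …, x_n ∈ R, and fix indices 1 ≤ i < j ≤ n+2. Let M be the n×n matrix whose columns are the powers x_k^c for the n exponents c ∈ {0, 1, …, n+1} \ {i-1, j-1}, listed in increasing order of c. Then det M = ( ē_{n+1-i} · ē_{n+2-j} − ē_{n+2-i} · ē_{n+1-j} ) · det V_n, a 2×2 determinant of elementary symmetric polynomials. -/
/-- `ē_m` for an integer index `m : ℤ`, equal to `0` for `m < 0`. -/
def ebarZ {R : Type*} [CommRing R] {n : ℕ} (x : Fin n → R) (m : ℤ) : R :=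
  if 0 ≤ m then ebar x m.toNat else 0

open Polynomial in
lemma vdm_coeff {R : Type*} [CommRing R] {n : ℕ} (x : Fin n → R) (c : ℕ) :
    (∏ k, (X - C (x k))).coeff c = (-1) ^ (n + c) * ebarZ x ((n : ℤ) - c) := by
  by_cases h : c ≤ n
  · have h1 : (∏ k, (X - C (x k))) = ∏ k, (X + C ((fun k => - x k) k)) := by
      simp [sub_eq_add_neg]
    rw [h1, Finset.prod_X_add_C_coeff _ _ (by simpa using h)]
    have h2 : ((n : ℤ) - c).toNat = n - c := by omega
    rw [ebarZ, if_pos (by omega), h2, ebar, Finset.mul_sum]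
    simp only [Finset.card_univ, Fintype.card_fin]
    refine Finset.sum_congr rfl fun s hs => ?_
    rw [Finset.prod_neg, (Finset.mem_powersetCard.1 hs).2]
    congr 1
    rw [show n + c = (n - c) + 2 * c by omega, pow_add, pow_mul]
    simp
  · rw [ebarZ, if_neg (by omega), mul_zero]
    apply coeff_eq_zero_of_natDegree_lt
    refine lt_of_le_of_lt (natDegree_prod_le _ _) ?_
    refine lt_of_le_of_lt (Finset.sum_le_card_nsmul _ _ 1 fun k _ => natDegree_X_sub_C_le _) ?_
    simp; omega

open Polynomial in
lemma vdm_coeff_X {R : Type*} [CommRing R] {n : ℕ} (x : Fin n → R) (c : ℕ) :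
    (X * ∏ k, (X - C (x k))).coeff c = (-1) ^ (n + c + 1) * ebarZ x ((n : ℤ) + 1 - c) := by
  cases c with
  | zero =>
    have : ((n : ℤ) + 1 - (0 : ℕ)).toNat = n + 1 := by omega
    rw [ebarZ, if_pos (by omega), this, ebar, Finset.powersetCard_eq_empty.2 (by simp)]
    simp
  | succ c =>
    rw [coeff_X_mul, vdm_coeff]
    have : (n : ℤ) + 1 - (c + 1 : ℕ) = n - c := by push_cast; ring
    rw [this, show n + (c + 1) + 1 = n + c + 2 by ring, pow_add _ _ 2]
    simp

/-- Vandermonde rows bordered by two unit rows. -/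
def vdmP {R : Type*} [CommRing R] {n : ℕ} (x : Fin n → R) (a b : ℕ) :
    Matrix (Fin (n + 2)) (Fin (n + 2)) R :=
  Matrix.of fun r c => if h : (r : ℕ) < n then x ⟨r, h⟩ ^ (c : ℕ)
    else if (r : ℕ) = n then (if (c : ℕ) = a then 1 else 0)
    else (if (c : ℕ) = b then 1 else 0)

open Polynomial in
/-- Unimodular column operations. -/
noncomputable def vdmQ {R : Type*} [CommRing R] {n : ℕ} (x : Fin n → R) :
    Matrix (Fin (n + 2)) (Fin (n + 2)) R :=
  Matrix.of fun c t => if (t : ℕ) < n then (if c = t then 1 else 0)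
    else if (t : ℕ) = n then (∏ k, (X - C (x k))).coeff c
    else (X * ∏ k, (X - C (x k))).coeff c

lemma vdmP_det {R : Type*} [CommRing R] {n : ℕ} (x : Fin n → R) (a b : ℕ)
    (hab : a < b) (hb : b < n + 2) :
    (vdmP x a b).det = (-1) ^ (a + b + 1) * (Matrix.of fun k t : Fin n =>
        x k ^ (if (t : ℕ) < a then (t : ℕ)
               else if (t : ℕ) < b - 1 then (t : ℕ) + 1
               else (t : ℕ) + 2)).det := by
  rw [Matrix.det_succ_row _ (Fin.last (n + 1)), Finset.sum_eq_single ⟨b, hb⟩]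
  · rw [Matrix.det_succ_row _ (Fin.last n), Finset.sum_eq_single ⟨a, by omega⟩]
    · have e1 : vdmP x a b (Fin.last (n + 1)) ⟨b, hb⟩ = 1 := by simp [vdmP]
      have e2 : (vdmP x a b).submatrix (Fin.last (n + 1)).succAbove
          (Fin.succAbove ⟨b, hb⟩) (Fin.last n) ⟨a, by omega⟩ = 1 := by
        simp [vdmP, Fin.succAbove, Fin.lt_def, hab]
      rw [e1, e2, mul_one, mul_one, ← mul_assoc, ← pow_add]
      congr 1
      · simp only [Fin.val_last]
        rw [show n + 1 + b + (n + a) = a + b + 1 + 2 * n by ring, pow_add _ _ (2 * n), pow_mul]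
        simp
      · congr 1
        ext k t
        have := k.2
        have := t.2
        simp only [vdmP, Matrix.submatrix_apply, Matrix.of_apply, Fin.succAbove_last,
          Fin.val_castSucc, k.2, dif_pos]
        congr 1
        simp only [Fin.succAbove, Fin.lt_def]
        split_ifs <;> simp_all <;> omega
    · intro c _ hc
      have hc' : (c : ℕ) ≠ a := fun h => hc (Fin.ext h)
      have : (vdmP x a b).submatrix (Fin.last (n + 1)).succAbove
          (Fin.succAbove ⟨b, hb⟩) (Fin.last n) c = 0 := by
        simp only [vdmP, Matrix.submatrix_apply, Matrix.of_apply, Fin.succAbove_last,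
          Fin.val_castSucc, Fin.val_last, lt_irrefl, dite_false, if_true]
        rw [if_neg]
        simp only [Fin.succAbove, Fin.lt_def]
        split_ifs <;> simp_all <;> omega
      rw [this]; simp
    · simp
  · intro c _ hc
    have hc' : (c : ℕ) ≠ b := fun h => hc (Fin.ext h)
    have : vdmP x a b (Fin.last (n + 1)) c = 0 := by simp [vdmP, hc']
    rw [this]; simp
  · simp

open Polynomial in
lemma vdm_natDegree {R : Type*} [CommRing R] {n : ℕ} (x : Fin n → R) :
    (∏ k, (X - C (x k))).natDegree ≤ n := by
  refine (natDegree_prod_le _ _).trans ?_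
  refine (Finset.sum_le_card_nsmul _ _ 1 fun k _ => natDegree_X_sub_C_le _).trans ?_
  simp

lemma vdmQ_det {R : Type*} [CommRing R] {n : ℕ} (x : Fin n → R) : (vdmQ x).det = 1 := by
  have z : ebarZ x 0 = 1 := by simp [ebarZ, ebar]
  rw [Matrix.det_of_isUpperTriangular]
  · refine Finset.prod_eq_one fun t _ => ?_
    have := t.2
    simp only [vdmQ, Matrix.of_apply]
    split_ifs with h1 h2
    · rfl
    · rw [vdm_coeff, h2]; simp [z, ← two_mul]
    · rw [vdm_coeff_X, show (t : ℕ) = n + 1 by omega]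
      simp [z, show n + (n + 1) + 1 = 2 * (n + 1) by ring]
  · intro c t h
    have h : (t : ℕ) < c := h
    simp only [vdmQ, Matrix.of_apply]
    split_ifs with h1 h2 h3
    · subst h2; omega
    · rfl
    · rw [vdm_coeff, ebarZ, if_neg (by omega), mul_zero]
    · rw [vdm_coeff_X, ebarZ, if_neg (by omega), mul_zero]

open Polynomial in
lemma vdmPQ_det {R : Type*} [CommRing R] {n : ℕ} (x : Fin n → R) (a b : ℕ)
    (hab : a < b) (hb : b < n + 2) :
    (vdmP x a b * vdmQ x).det = (Matrix.of fun k t : Fin n => x k ^ (t : ℕ)).det *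
      ((∏ k, (X - C (x k))).coeff a * (X * ∏ k, (X - C (x k))).coeff b
       - (X * ∏ k, (X - C (x k))).coeff a * (∏ k, (X - C (x k))).coeff b) := by
  set p := ∏ k, (X - C (x k)) with hp
  have hpd : p.natDegree ≤ n := vdm_natDegree x
  have hev : ∀ k, p.eval (x k) = 0 := fun k => by
    rw [hp, eval_prod]; exact Finset.prod_eq_zero (Finset.mem_univ k) (by simp)
  have hXd : (X * p).natDegree < n + 2 :=
    lt_of_le_of_lt natDegree_mul_le (by have := natDegree_X_le (R := R); omega)
  have s1 : ∀ k, ∑ c : Fin (n + 2), x k ^ (c : ℕ) * p.coeff c = 0 := fun k => by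
    rw [Fin.sum_univ_eq_sum_range (fun c => x k ^ c * p.coeff c), ← hev k,
      eval_eq_sum_range' (n := n + 2) (by omega)]
    exact Finset.sum_congr rfl fun _ _ => mul_comm _ _
  have s2 : ∀ k, ∑ c : Fin (n + 2), x k ^ (c : ℕ) * (X * p).coeff c = 0 := fun k => by
    have : (X * p).eval (x k) = 0 := by simp [hev]
    generalize X * p = q at *
    rw [Fin.sum_univ_eq_sum_range (fun c => x k ^ c * q.coeff c), ← this,
      eval_eq_sum_range' hXd]
    exact Finset.sum_congr rfl fun _ _ => mul_comm _ _
  have s3 : ∀ (q : R[X]) (d : ℕ), d < n + 2 →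
      ∑ c : Fin (n + 2), (if (c : ℕ) = d then 1 else 0) * q.coeff c = q.coeff d := by
    intro q d hd
    rw [Finset.sum_eq_single ⟨d, hd⟩]
    · simp
    · intro c _ hc
      rw [if_neg (fun h => hc (Fin.ext h)), zero_mul]
    · simp
  rw [← Matrix.det_submatrix_equiv_self (finSumFinEquiv (m := n) (n := 2)),
    ← Matrix.fromBlocks_toBlocks (Matrix.submatrix _ _ _)]
  have hz : (Matrix.submatrix (vdmP x a b * vdmQ x) (finSumFinEquiv (m := n) (n := 2))
      (finSumFinEquiv (m := n) (n := 2))).toBlocks₁₂ = 0 := by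
    ext k t
    simp only [Matrix.toBlocks₁₂, Matrix.of_apply, Matrix.submatrix_apply, Matrix.mul_apply,
      finSumFinEquiv_apply_left, finSumFinEquiv_apply_right, vdmP, vdmQ, Matrix.zero_apply]
    fin_cases t
    · simpa using s1 k
    · simpa using s2 k
  rw [hz, Matrix.det_fromBlocks_zero₁₂]
  congr 1
  · congr 1
    ext k t
    simp [Matrix.toBlocks₁₁, Matrix.mul_apply, vdmP, vdmQ]
  · rw [Matrix.det_fin_two]
    have q1 := s3 p a (by omega)
    have q2 := s3 p b hb
    have q3 := s3 (X * p) a (by omega)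
    have q4 := s3 (X * p) b hb
    rw [← q1, ← q2, ← q3, ← q4]
    simp [Matrix.toBlocks₂₂, Matrix.mul_apply, vdmP, vdmQ, hp]

/-- For `1 ≤ i < j ≤ n+2`, let `M` be the `n × n` matrix whose columns are the powers
`x_k^c` for the `n` exponents `c ∈ {0,1,…,n+1} \ {i-1, j-1}` in increasing order
(the extended Vandermonde matrix `V_{n,n+2}` with its `i`-th and `j`-th columns
deleted).  Then `det M = (ē_{n+1-i} ē_{n+2-j} − ē_{n+2-i} ē_{n+1-j}) · det V_n`. -/
theorem det_vandermonde_delete_two_columns {R : Type*} [CommRing R]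
    (n : ℕ) (hn : 1 ≤ n) (x : Fin n → R) (i j : ℕ)
    (hi : 1 ≤ i) (hij : i < j) (hj : j ≤ n + 2) :
    (Matrix.of fun k t : Fin n =>
        x k ^ (if (t : ℕ) < i - 1 then (t : ℕ)
               else if (t : ℕ) < j - 2 then (t : ℕ) + 1
               else (t : ℕ) + 2)).det
      = (ebarZ x ((n : ℤ) + 1 - i) * ebarZ x ((n : ℤ) + 2 - j)
          - ebarZ x ((n : ℤ) + 2 - i) * ebarZ x ((n : ℤ) + 1 - j)) *
        (Matrix.of fun k t : Fin n => x k ^ (t : ℕ)).det := by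
  obtain ⟨a, rfl⟩ : ∃ a, i = a + 1 := ⟨i - 1, by omega⟩
  obtain ⟨b, rfl⟩ : ∃ b, j = b + 1 := ⟨j - 1, by omega⟩
  have h1 := vdmP_det x a b (by omega) (by omega)
  have h2 := vdmPQ_det x a b (by omega) (by omega)
  rw [Matrix.det_mul, vdmQ_det, mul_one, h1, vdm_coeff, vdm_coeff, vdm_coeff_X, vdm_coeff_X] at h2
  have e1 : (n : ℤ) + 1 - (a + 1 : ℕ) = n - a := by push_cast; ring
  have e2 : (n : ℤ) + 2 - (b + 1 : ℕ) = n + 1 - b := by push_cast; ring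
  have e3 : (n : ℤ) + 2 - (a + 1 : ℕ) = n + 1 - a := by push_cast; ring
  have e4 : (n : ℤ) + 1 - (b + 1 : ℕ) = n - b := by push_cast; ring
  rw [e1, e2, e3, e4, show a + 1 - 1 = a by omega, show b + 1 - 2 = b - 1 by omega]
  have hs : ((-1 : R) ^ (a + b + 1)) * (-1) ^ (a + b + 1) = 1 := by
    rw [← mul_pow]; simp
  have hN : ((-1 : R) ^ n) * (-1) ^ n = 1 := by
    rw [← mul_pow]; simp
  have h3 := congrArg (fun y => (-1 : R) ^ (a + b + 1) * y) h2
  simp only [← mul_assoc, hs, one_mul] at h3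
  rw [h3]
  have k1 : (-1 : R) ^ (n + a) * (-1) ^ (n + b + 1) = (-1) ^ (a + b + 1) := by
    linear_combination (-1 : R) ^ (a + b + 1) * hN
  have k2 : (-1 : R) ^ (n + a + 1) * (-1) ^ (n + b) = (-1) ^ (a + b + 1) := by
    linear_combination (-1 : R) ^ (a + b + 1) * hN
  generalize (Matrix.of fun k t : Fin n => x k ^ (t : ℕ)).det = D
  generalize ebarZ x ((n : ℤ) - a) = A
  generalize ebarZ x ((n : ℤ) + 1 - b) = B
  generalize ebarZ x ((n : ℤ) + 1 - a) = E
  generalize ebarZ x ((n : ℤ) - b) = F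
  generalize (-1 : R) ^ (a + b + 1) = S at *
  generalize (-1 : R) ^ (n + a + 1) = S1 at *
  generalize (-1 : R) ^ (n + a) = S2 at *
  generalize (-1 : R) ^ (n + b + 1) = S3 at *
  generalize (-1 : R) ^ (n + b) = S4 at *
  linear_combination S * D * A * B * k1 - S * D * E * F * k2 + D * (A * B - E * F) * hs
end
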